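/- arXiv:2106.06806 — 2 statements merged into one kernel-verified Lean document; each statement's English description precedes it below -/
import Mathlib

section
/- (Discrete maximum principle for the first-order IMEX scheme.) Let d ≥ 1, κ > 0, and 0 < τ ≤ 1. Let (u^n)_{n≥0} be a sequence of smooth functions ℝ^d → ℝ, each 2π-periodic in every coordinate, satisfying for every n ≥ 0 and every x ∈ ℝ^d the scheme equation (u^{n+1}(x) - u^n(x))/τ = κ²Δu^{n+1}(x) + sin(u^n(x)). If |u^0(x)| ≤ π for all x, then |u^n(x)| ≤ π for all n ≥ 1 and all x ∈ ℝ^d. -/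
open Real

/-- The Laplacian of `f : ℝ^d → ℝ` at `x`, as the sum of second partial derivatives. -/
noncomputable def lap {d : ℕ} (f : (Fin d → ℝ) → ℝ) (x : Fin d → ℝ) : ℝ :=
  ∑ i, fderiv ℝ (fun y => fderiv ℝ f y (Pi.single i 1)) x (Pi.single i 1)

theorem deriv_deriv_nonpos_of_isLocalMax {g : ℝ → ℝ} {a : ℝ} (hc : ContinuousAt g a)
    (hg : IsLocalMax g a) : deriv (deriv g) a ≤ 0 := by
  by_contra! h
  have hmin := isLocalMin_of_deriv_deriv_pos h hg.deriv_eq_zero hc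
  have hconst : g =ᶠ[nhds a] fun _ => g a := by
    filter_upwards [hmin, hg] with y h1 h2 using le_antisymm h2 h1
  have hzero := hconst.deriv.deriv_eq
  simp only [deriv_const'] at hzero
  exact h.ne' hzero

theorem lap_nonpos_of_isMax {d : ℕ} {f : (Fin d → ℝ) → ℝ} (hf : ContDiff ℝ 2 f)
    {x : Fin d → ℝ} (hx : ∀ y, f y ≤ f x) : lap f x ≤ 0 := by
  refine Finset.sum_nonpos fun i _ => ?_
  set e : Fin d → ℝ := Pi.single i 1
  have hline (t : ℝ) : HasDerivAt (fun s : ℝ => x + s • e) e t := by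
    simpa using ((hasDerivAt_id t).smul_const e).const_add x
  have hd1 (t : ℝ) : HasDerivAt (fun s : ℝ => f (x + s • e)) (fderiv ℝ f (x + t • e) e) t :=
    ((hf.differentiable (by norm_num)) _).hasFDerivAt.comp_hasDerivAt t (hline t)
  have hf' : Differentiable ℝ fun y => fderiv ℝ f y e :=
    ((hf.fderiv_right (m := 1) (by norm_num)).clm_apply contDiff_const).differentiable
      (by norm_num)
  have hd2 : HasDerivAt (fun s : ℝ => fderiv ℝ f (x + s • e) e)
      (fderiv ℝ (fun y => fderiv ℝ f y e) x e) 0 := by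
    have h := (hf' (x + (0 : ℝ) • e)).hasFDerivAt.comp_hasDerivAt 0 (hline 0)
    rw [zero_smul, add_zero] at h
    exact h
  have h := deriv_deriv_nonpos_of_isLocalMax (hd1 0).continuousAt
    (Filter.Eventually.of_forall fun s => by simpa using hx (x + s • e))
  rwa [funext fun t => (hd1 t).deriv, hd2.deriv] at h

theorem lap_neg {d : ℕ} (f : (Fin d → ℝ) → ℝ) (x : Fin d → ℝ) :
    lap (fun y => -f y) x = -lap f x := by
  simp [lap, fderiv_fun_neg]

/-- A function on `ℝ^d` that is `c`-periodic in each coordinate takes all its values on the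
box `[0, c]^d`. -/
theorem exists_mem_Icc_eq_of_periodic {d : ℕ} {α : Type*} {f : (Fin d → ℝ) → α} {c : ℝ}
    (hc : 0 < c) (hf : ∀ x i, f (x + Pi.single i c) = f x) (x : Fin d → ℝ) :
    ∃ y ∈ Set.Icc (0 : Fin d → ℝ) (fun _ => c), f y = f x := by
  have key (k : Fin d → ℤ) (s : Finset (Fin d)) :
      f (x - ∑ i ∈ s, k i • Pi.single i c) = f x := by
    induction s using Finset.induction_on with
    | empty => simp
    | insert i s hi ih =>
      rw [Finset.sum_insert hi, add_comm, ← sub_sub,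
        Function.Periodic.sub_zsmul_eq (fun y => hf y i), ih]
  have hcoord (i : Fin d) : (x - ∑ j, toIcoDiv hc 0 (x j) • Pi.single j c) i
      = toIcoMod hc 0 (x i) := by
    simp [Finset.sum_apply, Pi.single_apply]
  refine ⟨_, ⟨fun i => ?_, fun i => ?_⟩, key (fun j => toIcoDiv hc 0 (x j)) Finset.univ⟩
  · rw [hcoord]
    exact left_le_toIcoMod hc 0 (x i)
  · rw [hcoord]
    simpa using (toIcoMod_lt_right hc 0 (x i)).le

theorem exists_forall_le_of_periodic {d : ℕ} {f : (Fin d → ℝ) → ℝ} {c : ℝ} (hc : 0 < c)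
    (hcont : Continuous f) (hf : ∀ x i, f (x + Pi.single i c) = f x) :
    ∃ x, ∀ y, f y ≤ f x := by
  obtain ⟨x, -, hx⟩ := (isCompact_Icc (a := (0 : Fin d → ℝ)) (b := fun _ => c)).exists_isMaxOn
    ⟨0, le_refl _, fun _ => hc.le⟩ hcont.continuousOn
  refine ⟨x, fun y => ?_⟩
  obtain ⟨z, hz, hzy⟩ := exists_mem_Icc_eq_of_periodic hc hf y
  exact hzy ▸ hx hz

theorem add_mul_sin_le_pi {τ s : ℝ} (hτ0 : 0 ≤ τ) (hτ1 : τ ≤ 1) (hs : s ≤ π) :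
    s + τ * sin s ≤ π := by
  have h : sin s ≤ π - s := by
    rw [← sin_pi_sub]
    exact sin_le (by linarith)
  nlinarith

/-- One step of the scheme preserves the upper bound `π`. -/
theorem imex_step_le_pi {d : ℕ} {κ τ : ℝ} (hτ0 : 0 < τ) (hτ1 : τ ≤ 1)
    {v w : (Fin d → ℝ) → ℝ} (hv : ContDiff ℝ 2 v)
    (hper : ∀ x i, v (x + Pi.single i (2 * π)) = v x)
    (hscheme : ∀ x, (v x - w x) / τ = κ ^ 2 * lap v x + sin (w x))
    (hw : ∀ x, w x ≤ π) (x : Fin d → ℝ) : v x ≤ π := by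
  obtain ⟨z, hz⟩ := exists_forall_le_of_periodic two_pi_pos hv.continuous hper
  refine (hz x).trans ?_
  have hlap : κ ^ 2 * lap v z ≤ 0 :=
    mul_nonpos_of_nonneg_of_nonpos (sq_nonneg κ) (lap_nonpos_of_isMax hv hz)
  have h : (v z - w z) / τ ≤ sin (w z) := by linarith [hscheme z]
  rw [div_le_iff₀ hτ0] at h
  linarith [add_mul_sin_le_pi hτ0.le hτ1 (hw z)]

/-- **Discrete maximum principle for the first-order IMEX scheme.**
For the scheme `(u^{n+1} - u^n)/τ = κ²Δu^{n+1} + sin(u^n)` with `0 < τ ≤ 1`,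
if `|u⁰| ≤ π` then `|uⁿ| ≤ π` for all `n ≥ 1`. -/
theorem imex_discrete_maximum_principle
    (d : ℕ) (hd : 1 ≤ d) (κ τ : ℝ) (hκ : 0 < κ) (hτ0 : 0 < τ) (hτ1 : τ ≤ 1)
    (u : ℕ → (Fin d → ℝ) → ℝ)
    (hsmooth : ∀ n : ℕ, ContDiff ℝ (⊤ : ℕ∞) (u n))
    (hper : ∀ n : ℕ, ∀ x : Fin d → ℝ, ∀ i : Fin d,
      u n (x + Pi.single i (2 * π)) = u n x)
    (hscheme : ∀ n : ℕ, ∀ x : Fin d → ℝ,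
      (u (n + 1) x - u n x) / τ = κ ^ 2 * lap (u (n + 1)) x + Real.sin (u n x))
    (hinit : ∀ x : Fin d → ℝ, |u 0 x| ≤ π) :
    ∀ n : ℕ, 1 ≤ n → ∀ x : Fin d → ℝ, |u n x| ≤ π := by
  suffices h : ∀ n x, |u n x| ≤ π from fun n _ => h n
  intro n
  induction n with
  | zero => exact hinit
  | succ n ih =>
    have hu : ContDiff ℝ 2 (u (n + 1)) := contDiff_infty.1 (hsmooth (n + 1)) 2
    refine fun x => abs_le'.2 ⟨?_, ?_⟩
    · exact imex_step_le_pi hτ0 hτ1 hu (hper (n + 1)) (hscheme n)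
        (fun y => (abs_le'.1 (ih y)).1) x
    · refine imex_step_le_pi (κ := κ) (v := fun y => -u (n + 1) y) (w := fun y => -u n y)
        hτ0 hτ1 hu.neg (fun y i => by rw [hper]) (fun y => ?_) (fun y => (abs_le'.1 (ih y)).2) x
      rw [lap_neg, sin_neg]
      linear_combination -hscheme n y
end

section
/- (Energy dissipation of the BDF2 scheme.) Let d ≥ 1, κ > 0, and 0 < τ ≤ 1/2. Let (u^n)_{n≥0} be a sequence of smooth functions ℝ^d → ℝ, each 2π-periodic in every coordinate, satisfying for every n ≥ 1 and every x the scheme equation (3u^{n+1}(x) - 4u^n(x) + u^{n-1}(x))/(2τ) = κ²Δu^{n+1}(x) + 2 sin(u^n(x)) - sin(u^{n-1}(x)). Define the modified energy Ẽ(u^n) = (κ²/2)∫_{[-π,π]^d} |∇u^n|² dx + ∫_{[-π,π]^d} cos(u^n) dx + (1/(4τ))∫_{[-π,π]^d} (u^n - u^{n-1})² dx for n ≥ 1. Then Ẽ(u^{n+1}) ≤ Ẽ(u^n) for all n ≥ 1. -/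
open MeasureTheory Real

/-- The squared norm of the spatial gradient of `f : ℝ^d → ℝ` at `x`. -/
noncomputable def gradNormSq {d : ℕ} (f : (Fin d → ℝ) → ℝ) (x : Fin d → ℝ) : ℝ :=
  ∑ i, (fderiv ℝ f x (Pi.single i 1)) ^ 2

/-- The fundamental cell `[-π, π]^d` of the torus. -/
def torusBox (d : ℕ) : Set (Fin d → ℝ) :=
  Set.univ.pi fun _ => Set.Icc (-π) π

/-- The sine-Gordon energy `E(v) = ∫_{[-π,π]^d} (κ²/2 |∇v|² + cos v) dx`. -/
noncomputable def energy {d : ℕ} (κ : ℝ) (v : (Fin d → ℝ) → ℝ) : ℝ :=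
  ∫ x in torusBox d, (κ ^ 2 / 2 * gradNormSq v x + Real.cos (v x))

/-- The modified energy `Ẽ(uⁿ) = E(uⁿ) + (1/(4τ)) ‖uⁿ - uⁿ⁻¹‖²` used for the BDF2 scheme. -/
noncomputable def modifiedEnergy {d : ℕ} (κ τ : ℝ) (u : ℕ → (Fin d → ℝ) → ℝ) (n : ℕ) : ℝ :=
  energy κ (u n) + 1 / (4 * τ) * ∫ x in torusBox d, (u n x - u (n - 1) x) ^ 2

theorem Real.cos_sub_cos_le (a c : ℝ) :
    cos c - cos a ≤ -sin a * (c - a) + (c - a) ^ 2 / 2 := by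
  have hd : ∀ x : ℝ, HasDerivAt (fun y => y ^ 2 / 2 - cos y) (x + sin x) x := fun x => by
    have h := ((hasDerivAt_pow 2 x).div_const 2).fun_sub (hasDerivAt_cos x)
    exact h.congr_deriv (by norm_num)
  have hmono : Monotone fun x : ℝ => x + sin x := fun x y hxy => by
    have h := (abs_le.1 (abs_sin_sub_sin_le x y)).2
    rw [abs_of_nonpos (by linarith)] at h
    simp only
    linarith
  have hconv : ConvexOn ℝ Set.univ fun y : ℝ => y ^ 2 / 2 - cos y := by
    refine Monotone.convexOn_univ_of_deriv (fun x => (hd x).differentiableAt) ?_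
    rwa [funext fun x => (hd x).deriv]
  rcases lt_trichotomy a c with h | rfl | h
  · have h1 := hconv.le_slope_of_hasDerivAt (Set.mem_univ a) (Set.mem_univ c) h (hd a)
    rw [slope_def_field, le_div_iff₀ (by linarith)] at h1
    nlinarith
  · simp
  · have h1 := hconv.slope_le_of_hasDerivAt (Set.mem_univ c) (Set.mem_univ a) h (hd a)
    rw [slope_def_field, div_le_iff₀ (by linarith)] at h1
    nlinarith

/-- The pointwise energy inequality for the reaction part of one BDF2 step from `b`, `a` to `c`,
where `D` stands for the diffusion term. -/
theorem bdf2_reaction_inequality {τ : ℝ} (hτ0 : 0 < τ) (hτh : τ ≤ 1 / 2) {a b c D : ℝ}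
    (h : (3 * c - 4 * a + b) / (2 * τ) = D + 2 * sin a - sin b) :
    cos c + 1 / (4 * τ) * (c - a) ^ 2 - (cos a + 1 / (4 * τ) * (a - b) ^ 2) ≤ D * (c - a) := by
  have hcos := cos_sub_cos_le a c
  have hD : D = (3 * (c - a) - (a - b)) / (2 * τ) - 2 * sin a + sin b := by
    rw [show 3 * (c - a) - (a - b) = 3 * c - 4 * a + b by ring, h]; ring
  have hsin : (sin a - sin b) * (c - a) ≤ |a - b| * |c - a| :=
    (le_abs_self _).trans <| by
      rw [abs_mul]; exact mul_le_mul_of_nonneg_right (abs_sin_sub_sin_le a b) (abs_nonneg _)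
  have hmul : (a - b) * (c - a) ≤ |a - b| * |c - a| := by
    rw [← abs_mul]; exact le_abs_self _
  have hw := sq_abs (c - a)
  have hv := sq_abs (a - b)
  rw [hD]
  generalize |a - b| = V at *
  generalize |c - a| = W at *
  have key : (c - a) ^ 2 / 2 + V * W + 1 / (4 * τ) * ((c - a) ^ 2 - (a - b) ^ 2)
      ≤ (3 * (c - a) - (a - b)) / (2 * τ) * (c - a) := by
    have : 0 ≤ (6 * (c - a) ^ 2 - 2 * ((a - b) * (c - a)) - 4 * τ * ((c - a) ^ 2 / 2 + V * W)
        - ((c - a) ^ 2 - (a - b) ^ 2)) / (4 * τ) := by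
      refine div_nonneg ?_ (by linarith)
      have h1 : 0 ≤ (5 - 2 * τ) * W ^ 2 - (2 + 4 * τ) * (V * W) + V ^ 2 := by
        nlinarith [sq_nonneg (V - (1 + 2 * τ) * W),
          mul_nonneg (mul_nonneg (sub_nonneg.2 hτh) (by linarith : 0 ≤ τ + 2)) (sq_nonneg W)]
      rw [← hw, ← hv]
      linarith
    rw [← sub_nonneg]
    convert this using 1
    field_simp
    ring
  linarith

section

variable {d : ℕ}

theorem Fin.insertNth_add_single {n : ℕ} (i : Fin (n + 1)) (a t : ℝ) (y : Fin n → ℝ) :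
    (i.insertNth (a + t) y : Fin (n + 1) → ℝ) = i.insertNth a y + Pi.single i t := by
  ext j
  refine Fin.succAboveCases i ?_ (fun k => ?_) j <;> simp

theorem torusBox_eq_Icc (d : ℕ) : torusBox d = Set.Icc (fun _ => -π) (fun _ => π) :=
  Set.pi_univ_Icc _ _

theorem Continuous.integrableOn_torusBox {f : (Fin d → ℝ) → ℝ} (hf : Continuous f) :
    IntegrableOn f (torusBox d) := by
  rw [torusBox_eq_Icc]
  exact hf.continuousOn.integrableOn_compact isCompact_Icc

/-- The divergence of a periodic vector field has zero integral over the fundamental cell. -/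
theorem integral_torusBox_divergence_eq_zero {n : ℕ} (F : Fin (n + 1) → (Fin (n + 1) → ℝ) → ℝ)
    (hF : ∀ i, ContDiff ℝ 1 (F i))
    (hper : ∀ i x, F i (x + Pi.single i (2 * π)) = F i x) :
    ∫ x in torusBox (n + 1), ∑ i, fderiv ℝ (F i) x (Pi.single i 1) = 0 := by
  have hcont : Continuous fun x => ∑ i, fderiv ℝ (F i) x (Pi.single i 1) :=
    continuous_finsetSum _ fun i _ =>
      ((hF i).continuous_fderiv one_ne_zero).clm_apply continuous_const
  have h_int := hcont.integrableOn_torusBox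
  rw [torusBox_eq_Icc] at h_int ⊢
  rw [integral_divergence_of_hasFDerivAt_off_countable' _ _ (fun _ => by linarith [pi_pos]) F
    (fun i x => fderiv ℝ (F i) x) ∅ Set.countable_empty (fun i => (hF i).continuous.continuousOn)
    (fun x _ i => ((hF i).differentiable one_ne_zero x).hasFDerivAt) h_int]
  refine Finset.sum_eq_zero fun i _ => sub_eq_zero.2 ?_
  congr 1
  ext y
  rw [← hper i (i.insertNth (-π) y), ← Fin.insertNth_add_single]
  ring_nf

theorem fderiv_mul_sub_single {f g : (Fin d → ℝ) → ℝ} (hf : ContDiff ℝ (⊤ : ℕ∞) f)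
    (hg : ContDiff ℝ (⊤ : ℕ∞) g) (e x : Fin d → ℝ) :
    fderiv ℝ (fun y => fderiv ℝ f y e * (f y - g y)) x e =
      fderiv ℝ (fun y => fderiv ℝ f y e) x e * (f x - g x) +
        fderiv ℝ f x e * (fderiv ℝ f x e - fderiv ℝ g x e) := by
  have hf' : DifferentiableAt ℝ f x := hf.differentiable (by simp) x
  have hg' : DifferentiableAt ℝ g x := hg.differentiable (by simp) x
  have hdf : DifferentiableAt ℝ (fun y => fderiv ℝ f y e) x :=
    ((hf.fderiv_right (m := 1) (by norm_cast)).clm_apply contDiff_const).differentiable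
      one_ne_zero x
  rw [fderiv_fun_mul hdf (hf'.fun_sub hg'), fderiv_fun_sub hf' hg']
  simp
  ring

theorem ContDiff.continuous_gradNormSq {f : (Fin d → ℝ) → ℝ} (hf : ContDiff ℝ (⊤ : ℕ∞) f) :
    Continuous (gradNormSq f) :=
  continuous_finsetSum _ fun _ _ =>
    ((hf.continuous_fderiv (by simp)).clm_apply continuous_const).pow 2

/-- Discrete form of `∫ (½ ∂ₜ|∇u|² + Δu ∂ₜu) ≤ 0`, as an inequality of integrands. -/
theorem gradNormSq_sub_le {f g : (Fin d → ℝ) → ℝ} (hf : ContDiff ℝ (⊤ : ℕ∞) f)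
    (hg : ContDiff ℝ (⊤ : ℕ∞) g) (x : Fin d → ℝ) :
    (gradNormSq f x - gradNormSq g x) / 2 + lap f x * (f x - g x) ≤
      ∑ i, fderiv ℝ (fun y => fderiv ℝ f y (Pi.single i 1) * (f y - g y)) x (Pi.single i 1) := by
  simp only [fderiv_mul_sub_single hf hg, gradNormSq, lap]
  rw [Finset.sum_add_distrib, ← Finset.sum_mul, ← Finset.sum_sub_distrib, Finset.sum_div, add_comm]
  gcongr with i
  nlinarith [sq_nonneg (fderiv ℝ f x (Pi.single i 1) - fderiv ℝ g x (Pi.single i 1))]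

theorem modifiedEnergy_eq_integral {κ τ : ℝ} {u : ℕ → (Fin d → ℝ) → ℝ}
    (hu : ∀ n : ℕ, ContDiff ℝ (⊤ : ℕ∞) (u n)) (n : ℕ) :
    IntegrableOn (fun x => κ ^ 2 / 2 * gradNormSq (u n) x + cos (u n x)
        + 1 / (4 * τ) * (u n x - u (n - 1) x) ^ 2) (torusBox d) ∧
      modifiedEnergy κ τ u n = ∫ x in torusBox d, (κ ^ 2 / 2 * gradNormSq (u n) x + cos (u n x)
        + 1 / (4 * τ) * (u n x - u (n - 1) x) ^ 2) := by
  have h1 : IntegrableOn (fun x => κ ^ 2 / 2 * gradNormSq (u n) x + cos (u n x)) (torusBox d) :=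
    ((continuous_const.mul (hu n).continuous_gradNormSq).add
      (continuous_cos.comp (hu n).continuous)).integrableOn_torusBox
  have h2 : IntegrableOn (fun x => 1 / (4 * τ) * (u n x - u (n - 1) x) ^ 2) (torusBox d) :=
    (continuous_const.mul
      (((hu n).continuous.sub (hu (n - 1)).continuous).pow 2)).integrableOn_torusBox
  refine ⟨h1.add h2, ?_⟩
  rw [modifiedEnergy, energy, integral_add h1 h2, integral_const_mul]

end

/-- **Energy dissipation of the BDF2 scheme.**
For the scheme `(3u^{n+1} - 4uⁿ + u^{n-1})/(2τ) = κ²Δu^{n+1} + 2 sin(uⁿ) - sin(u^{n-1})`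
with `0 < τ ≤ 1/2`, the modified energy `Ẽ(uⁿ)` is nonincreasing for `n ≥ 1`. -/
theorem bdf2_energy_dissipation
    (d : ℕ) (hd : 1 ≤ d) (κ τ : ℝ) (hκ : 0 < κ) (hτ0 : 0 < τ) (hτh : τ ≤ 1 / 2)
    (u : ℕ → (Fin d → ℝ) → ℝ)
    (hsmooth : ∀ n : ℕ, ContDiff ℝ (⊤ : ℕ∞) (u n))
    (hper : ∀ n : ℕ, ∀ x : Fin d → ℝ, ∀ i : Fin d,
      u n (x + Pi.single i (2 * π)) = u n x)
    (hscheme : ∀ n : ℕ, 1 ≤ n → ∀ x : Fin d → ℝ,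
      (3 * u (n + 1) x - 4 * u n x + u (n - 1) x) / (2 * τ) =
        κ ^ 2 * lap (u (n + 1)) x + 2 * Real.sin (u n x) - Real.sin (u (n - 1) x)) :
    ∀ n : ℕ, 1 ≤ n → modifiedEnergy κ τ u (n + 1) ≤ modifiedEnergy κ τ u n := by
  intro n hn
  obtain ⟨m, rfl⟩ : ∃ m, d = m + 1 := ⟨d - 1, by omega⟩
  obtain ⟨hi₁, he₁⟩ := modifiedEnergy_eq_integral (κ := κ) (τ := τ) hsmooth (n + 1)
  obtain ⟨hi₀, he₀⟩ := modifiedEnergy_eq_integral (κ := κ) (τ := τ) hsmooth n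
  let F : Fin (m + 1) → (Fin (m + 1) → ℝ) → ℝ := fun i y =>
    fderiv ℝ (u (n + 1)) y (Pi.single i 1) * (u (n + 1) y - u n y)
  have hF : ∀ i, ContDiff ℝ 1 (F i) := fun i =>
    (((hsmooth (n + 1)).fderiv_right (by norm_cast)).clm_apply contDiff_const).mul
      (((hsmooth (n + 1)).sub (hsmooth n)).of_le (by norm_cast))
  have hFper : ∀ i x, F i (x + Pi.single i (2 * π)) = F i x := fun i x => by
    simp only [F, hper]
    rw [← fderiv_comp_add_right, funext fun y => hper (n + 1) y i]
  have hzero := integral_torusBox_divergence_eq_zero F hF hFper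
  have hcont : Continuous fun x => κ ^ 2 * ∑ i, fderiv ℝ (F i) x (Pi.single i 1) :=
    continuous_const.mul <| continuous_finsetSum _ fun i _ =>
      ((hF i).continuous_fderiv one_ne_zero).clm_apply continuous_const
  rw [← sub_nonpos, he₁, he₀, ← integral_sub hi₁ hi₀]
  calc _ ≤ ∫ x in torusBox (m + 1), κ ^ 2 * ∑ i, fderiv ℝ (F i) x (Pi.single i 1) := by
        refine integral_mono (hi₁.sub hi₀) hcont.integrableOn_torusBox fun x => ?_
        have hgrad := mul_le_mul_of_nonneg_left
          (gradNormSq_sub_le (hsmooth (n + 1)) (hsmooth n) x) (sq_nonneg κ)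
        have hreact := bdf2_reaction_inequality hτ0 hτh (hscheme n hn x)
        simp only [Nat.add_sub_cancel, F]
        linarith
    _ = 0 := by rw [integral_const_mul, hzero, mul_zero]
end
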